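/- arXiv:1510.04712 — 2 statements merged into one kernel-verified Lean document; each statement's English description precedes it below -/
import Mathlib

section
/- Fix integers n ≥ p ≥ 2. For every DCS digraph G on n agents with any number m ≤ n of dedicated observers and agent-to-agent edges constrained to the platooning pattern E_{X,X} ⊆ {(x_i, x_{i+k}) : 1 ≤ i ≤ n, 0 ≤ k ≤ p, i + k ≤ n}, the full robustness condition fails: there exists an agent x ∈ X (in particular x = x_n) and a vertex separator of (x, o) in the augmented graph G′ of cardinality strictly less than p. Hence under the platooning constraint no configuration is structurally left invertible for all feasible attacks on agents and sensors. -/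
/-- A walk from `a` to `b` along the edge relation `E`, recorded as its list of vertices. -/
def IsWalk {V : Type*} (E : V → V → Prop) (a b : V) (P : List V) : Prop :=
  P.Chain' E ∧ P.head? = some a ∧ P.getLast? = some b

/-- `S` is a vertex separator of the pair `(a, b)`: `a, b ∉ S` and every
path from `a` to `b` meets `S`. -/
def IsSeparator {V : Type*} (E : V → V → Prop) (a b : V) (S : Set V) : Prop :=
  a ∉ S ∧ b ∉ S ∧ ∀ P : List V, IsWalk E a b P → ∃ s ∈ S, s ∈ P

/-- A `q`-linking from `A` to `B`: `q` pairwise vertex-disjoint simple paths,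
each starting in `A` and ending in `B`. -/
def HasLinking {V : Type*} (E : V → V → Prop) (A B : Set V) (q : ℕ) : Prop :=
  ∃ P : Fin q → List V,
    (∀ i, (P i).Nodup ∧ ∃ a ∈ A, ∃ b ∈ B, IsWalk E a b (P i)) ∧
    ∀ i j, i ≠ j → ∀ v, v ∈ P i → v ∉ P j

/-- `q` internally disjoint simple paths from `a` to `b`. -/
def HasInternallyDisjoint {V : Type*} (E : V → V → Prop) (a b : V) (q : ℕ) : Prop :=
  ∃ P : Fin q → List V,
    (∀ i, (P i).Nodup ∧ IsWalk E a b (P i)) ∧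
    ∀ i j, i ≠ j → ∀ v, v ∈ P i → v ∈ P j → v = a ∨ v = b

/-- A DCS digraph on `n` agents (`Sum.inl`) and `m` observers (`Sum.inr`):
every agent has a self-loop, each observer has exactly one incoming edge, which comes
from its (dedicated) agent `obs j`, distinct observers observe distinct agents, and
observers have no outgoing edges. -/
structure DCS (n m : ℕ) where
  E : (Fin n ⊕ Fin m) → (Fin n ⊕ Fin m) → Prop
  obs : Fin m → Fin n
  obs_inj : Function.Injective obs
  selfLoop : ∀ i : Fin n, E (Sum.inl i) (Sum.inl i)
  obs_in : ∀ (j : Fin m) (i : Fin n), E (Sum.inl i) (Sum.inr j) ↔ i = obs j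
  obs_noOut : ∀ (j : Fin m) (v : Fin n ⊕ Fin m), ¬ E (Sum.inr j) v

/-- Agent `x` is measured by some observer. -/
def Observed {n m : ℕ} (G : DCS n m) (x : Fin n) : Prop := ∃ j, G.obs j = x

/-- The augmented graph `G′`: a new vertex `o = Sum.inr ()` is added, with an
edge from every observer to `o`. -/
def augE {n m : ℕ} (G : DCS n m) :
    ((Fin n ⊕ Fin m) ⊕ Unit) → ((Fin n ⊕ Fin m) ⊕ Unit) → Prop
  | Sum.inl a, Sum.inl b => G.E a b
  | Sum.inl (Sum.inr _), Sum.inr _ => True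
  | _, _ => False

/-- The collapsed graph `G″`: observers are deleted, a new vertex `o = Sum.inr ()`
is added, and every observed agent gets an edge to `o`. -/
def colE {n m : ℕ} (G : DCS n m) :
    (Fin n ⊕ Unit) → (Fin n ⊕ Unit) → Prop
  | Sum.inl a, Sum.inl b => G.E (Sum.inl a) (Sum.inl b)
  | Sum.inl a, Sum.inr _ => ∃ j, G.obs j = a
  | _, _ => False

/-- The attacked graph `G^a_F`: one new (dedicated) input vertex for each element
of `F`, with a single edge from that input vertex to its element of `F`. -/
def atkE {V : Type*} (E : V → V → Prop) (F : Set V) :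
    (V ⊕ ↥F) → (V ⊕ ↥F) → Prop
  | Sum.inl a, Sum.inl b => E a b
  | Sum.inr u, Sum.inl b => (u : V) = b
  | _, _ => False

/-- The number of agent-to-agent edges (self-loops included), i.e. `‖A‖₀`. -/
noncomputable def agentEdgeCount {n m : ℕ} (G : DCS n m) : ℕ :=
  {e : Fin n × Fin n | G.E (Sum.inl e.1) (Sum.inl e.2)}.ncard

/-- Robustness to attacks on agents and sensors: every vertex separator of any
`(x, o)` in the augmented graph `G′` has cardinality at least `p`. -/
def RobustXY {n m : ℕ} (G : DCS n m) (p : ℕ) : Prop :=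
  ∀ (x : Fin n) (S : Set ((Fin n ⊕ Fin m) ⊕ Unit)),
    IsSeparator (augE G) (Sum.inl (Sum.inl x)) (Sum.inr ()) S → p ≤ S.ncard

/-- Robustness to agent-only attacks: for every unobserved agent `x`, every vertex
separator of `(x, o)` in the collapsed graph `G″` has cardinality at least `p`. -/
def RobustX {n m : ℕ} (G : DCS n m) (p : ℕ) : Prop :=
  ∀ x : Fin n, ¬ Observed G x → ∀ S : Set (Fin n ⊕ Unit),
    IsSeparator (colE G) (Sum.inl x) (Sum.inr ()) S → p ≤ S.ncard

/-- A property that holds at the start of a walk and is preserved along edges holds at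
every vertex of the walk. -/
theorem IsWalk.forall_mem {V : Type*} {E : V → V → Prop} {a b : V} {P : List V}
    (hP : IsWalk E a b P) {S : Set V} (hS : ∀ v ∈ P, v ∉ S) {Q : V → Prop} (ha : Q a)
    (hQ : ∀ u v, Q u → E u v → v ∉ S → Q v) : ∀ v ∈ P, Q v := by
  obtain ⟨hchain, hhead, -⟩ := hP
  induction P generalizing a with
  | nil => simp
  | cons c l ih =>
    obtain rfl : c = a := by simpa using hhead
    intro v hv
    rcases List.mem_cons.1 hv with rfl | hv
    · exact ha
    · cases l with
      | nil => simp at hv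
      | cons d t =>
        have hcd := List.isChain_cons_cons.1 hchain
        exact ih (fun w hw => hS w (List.mem_cons_of_mem _ hw))
          (hQ c d ha hcd.1 (hS d (by simp))) hcd.2 rfl v hv

/-- If every edge leaving `a` leads back to `a` or into `S`, then `S` separates `a` from
any other vertex outside `S`. -/
theorem IsSeparator.of_out_edges {V : Type*} {E : V → V → Prop} {a b : V} {S : Set V}
    (hab : a ≠ b) (ha : a ∉ S) (hb : b ∉ S) (hout : ∀ v, E a v → v = a ∨ v ∈ S) :
    IsSeparator E a b S := by
  refine ⟨ha, hb, fun P hP => ?_⟩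
  by_contra! hS
  have hmem : ∀ v ∈ P, v = a :=
    hP.forall_mem (fun v hv hvS => hS v hvS hv) rfl
      fun u v hu huv hv => (hout v (hu ▸ huv)).resolve_right hv
  exact hab (hmem b (List.mem_of_getLast? hP.2.2)).symm

/-- Under the platooning constraint (an edge from `x_i` only to some `x_{i+k}` with
`0 ≤ k ≤ p`), for `p ≥ 2` the full robustness condition fails for any number `m ≤ n`
of dedicated observers: some agent `x` (in particular the last agent `x_n`) admits a
vertex separator of `(x, o)` in the augmented graph `G′` of cardinality strictly less
than `p`. Hence no platooning configuration is structurally left invertible for all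
feasible attacks on agents and sensors. -/
theorem platooning_not_robustXY {n p : ℕ} (hp : 2 ≤ p) (hpn : p ≤ n)
    {m : ℕ} (hmn : m ≤ n) (G : DCS n m)
    (hplat : ∀ a b : Fin n, G.E (Sum.inl a) (Sum.inl b) →
      (a : ℕ) ≤ (b : ℕ) ∧ (b : ℕ) ≤ (a : ℕ) + p) :
    ∃ (x : Fin n) (S : Set ((Fin n ⊕ Fin m) ⊕ Unit)),
      x = ⟨n - 1, by omega⟩ ∧
      IsSeparator (augE G) (Sum.inl (Sum.inl x)) (Sum.inr ()) S ∧ S.ncard < p := by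
  refine ⟨⟨n - 1, by omega⟩, (fun j => Sum.inl (Sum.inr j)) '' {j | G.obs j = ⟨n - 1, by omega⟩},
    rfl, IsSeparator.of_out_edges (by simp) (by simp) (by simp) ?_, ?_⟩
  · rintro ((b | j) | u) h
    · have hb := hplat _ _ h
      left
      congr 2
      ext
      have := b.isLt
      simp only at hb ⊢
      omega
    · exact Or.inr ⟨j, ((G.obs_in j _).1 h).symm, rfl⟩
    · exact h.elim
  · refine lt_of_le_of_lt ?_ hp
    have hsub : {j | G.obs j = ⟨n - 1, by omega⟩}.Subsingleton :=
      fun j hj k hk => G.obs_inj (hj.trans hk.symm)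
    exact Set.ncard_le_one_iff_subsingleton.2 (hsub.image _)
end

section
/- Fix integers n ≥ m ≥ p ≥ 1. Let G be the relaxed platooning DCS digraph on agents x_1,…,x_n in which agents x_{n−m+1},…,x_n are observed by dedicated sensors, each unobserved agent x_i (1 ≤ i ≤ n − m) has its self-loop plus edges to x_{i+1},…,x_{i+p}, and each observed agent has its self-loop, the edge to its observer, and edges to p − 1 other observed agents arranged cyclically (agent x_{n−m+j} has edges to x_{n−m+((j+l−1) mod m)+1} for l = 1,…,p−1). Then G has exactly np + n − m agent-to-agent edges (self-loops included), and for every agent x ∈ X, every vertex separator of (x, o) in the augmented graph G′ has cardinality at least p. -/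
/-- If `S` has fewer than `p` points, some member of a pairwise disjoint family of `p` sets misses it. -/
theorem exists_disjoint_of_ncard_lt {V : Type*} [Finite V] {p : ℕ} (T : Fin p → Set V)
    (hT : ∀ i j v, v ∈ T i → v ∈ T j → i = j) (S : Set V) (hS : S.ncard < p) :
    ∃ i, ∀ v ∈ T i, v ∉ S := by
  by_contra! h
  choose f hf hfS using h
  have hinj : Function.Injective f := fun i j hij => hT i j (f i) (hf i) (hij ▸ hf j)
  have hle := Set.ncard_le_ncard (Set.range_subset_iff.2 hfS) (Set.toFinite S)
  rw [← Set.image_univ, Set.ncard_image_of_injective _ hinj, Set.ncard_univ, Nat.card_fin] at hle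
  omega

theorem ncard_setOf_prod {α β : Type*} [Fintype α] [Finite β] (R : α → β → Prop) :
    {e : α × β | R e.1 e.2}.ncard = ∑ a, {b | R a b}.ncard := by
  rw [← Nat.card_coe_set_eq]
  simp_rw [← Nat.card_coe_set_eq]
  rw [← Nat.card_sigma]
  exact Nat.card_congr
    { toFun := fun e => ⟨e.1.1, e.1.2, e.2⟩
      invFun := fun s => ⟨(s.1, s.2.1), s.2.2⟩
      left_inv := fun _ => rfl
      right_inv := fun _ => rfl }

theorem ncard_setOf_exists_lt {n r : ℕ} (f : ℕ → ℕ) (hf : ∀ k < r, f k < n)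
    (hinj : ∀ k < r, ∀ l < r, f k = f l → k = l) :
    {b : Fin n | ∃ k < r, (b : ℕ) = f k}.ncard = r := by
  have hrange : {b : Fin n | ∃ k < r, (b : ℕ) = f k} =
      Set.range fun k : Fin r => (⟨f k, hf k k.2⟩ : Fin n) := by
    ext b
    constructor
    · rintro ⟨k, hk, hb⟩
      exact ⟨⟨k, hk⟩, Fin.ext hb.symm⟩
    · rintro ⟨k, rfl⟩
      exact ⟨k, k.2, rfl⟩
  rw [hrange, ← Set.image_univ, Set.ncard_image_of_injective, Set.ncard_univ, Nat.card_fin]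
  intro k l hkl
  exact Fin.ext (hinj k k.2 l l.2 (Fin.mk.inj hkl))

theorem add_mod_injOn {m c k l : ℕ} (hk : k < m) (hl : l < m)
    (h : (c + k) % m = (c + l) % m) : k = l := by
  have h' : k ≡ l [MOD m] := Nat.ModEq.add_left_cancel' c h
  exact Nat.ModEq.eq_of_lt_of_lt h' hk hl

theorem isWalk_cons {V : Type*} {E : V → V → Prop} {a b c : V} {P : List V}
    (hab : E a b) (hP : IsWalk E b c P) : IsWalk E a c (a :: P) := by
  obtain ⟨hc, hh, hl⟩ := hP
  cases P with
  | nil => simp at hh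
  | cons d Q =>
    obtain rfl : d = b := by simpa using hh
    exact ⟨List.isChain_cons_cons.2 ⟨hab, hc⟩, rfl, by simpa using hl⟩

/-- There is a walk from `a` to `b` that avoids `S`. -/
def AvoidingReach {V : Type*} (E : V → V → Prop) (S : Set V) (a b : V) : Prop :=
  ∃ P, IsWalk E a b P ∧ ∀ v ∈ P, v ∉ S

theorem AvoidingReach.refl {V : Type*} {E : V → V → Prop} {S : Set V} {a : V} (ha : a ∉ S) :
    AvoidingReach E S a a :=
  ⟨[a], ⟨List.isChain_singleton a, rfl, rfl⟩, by simpa using ha⟩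

theorem AvoidingReach.cons {V : Type*} {E : V → V → Prop} {S : Set V} {a b c : V}
    (ha : a ∉ S) (hab : E a b) (h : AvoidingReach E S b c) : AvoidingReach E S a c := by
  obtain ⟨P, hP, hPS⟩ := h
  exact ⟨a :: P, isWalk_cons hab hP, by simpa using ⟨ha, hPS⟩⟩

/-- If every unobserved agent has edges to the next `p` agents and every observed agent has edges
to the `p` cyclically consecutive observed agents starting at itself, then `G` is robust. -/
theorem robustXY_of_edges {n m p : ℕ} (hpm : p ≤ m) (hmn : m ≤ n) (G : DCS n m)
    (hobs : ∀ j : Fin m, (G.obs j : ℕ) = n - m + (j : ℕ))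
    (hlow : ∀ a b : Fin n, (a : ℕ) < n - m → ∀ k ≤ p, (b : ℕ) = a + k →
      G.E (Sum.inl a) (Sum.inl b))
    (hhigh : ∀ a b : Fin n, n - m ≤ (a : ℕ) → ∀ l < p,
      (b : ℕ) = n - m + (((a : ℕ) - (n - m)) + l) % m → G.E (Sum.inl a) (Sum.inl b)) :
    RobustXY G p := by
  rintro x S ⟨hx, ho, hsep⟩
  by_contra! hlt
  have observed : ∀ a : Fin n, n - m ≤ (a : ℕ) → Sum.inl (Sum.inl a) ∉ S →
      AvoidingReach (augE G) S (Sum.inl (Sum.inl a)) (Sum.inr ()) := by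
    intro a ha haS
    have hm : 0 < m := by have := a.2; omega
    let j : Fin p → Fin m := fun l => ⟨((a : ℕ) - (n - m) + l) % m, Nat.mod_lt _ hm⟩
    have hj : Function.Injective j := fun k l h =>
      Fin.ext (add_mod_injOn (by omega) (by omega) (Fin.mk.inj h))
    obtain ⟨l, hl⟩ := exists_disjoint_of_ncard_lt
      (fun l => {Sum.inl (Sum.inl (G.obs (j l))), Sum.inl (Sum.inr (j l))})
      (by
        rintro k l v (rfl | rfl) (h | h)
        · exact hj (G.obs_inj (Sum.inl.inj (Sum.inl.inj h)))
        · simp at h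
        · simp at h
        · exact hj (Sum.inr.inj (Sum.inl.inj h))) S hlt
    have h1 : augE G (Sum.inl (Sum.inl a)) (Sum.inl (Sum.inl (G.obs (j l)))) :=
      hhigh a _ ha l l.2 (hobs (j l))
    have h2 : augE G (Sum.inl (Sum.inl (G.obs (j l)))) (Sum.inl (Sum.inr (j l))) :=
      (G.obs_in _ _).2 rfl
    have h3 : augE G (Sum.inl (Sum.inr (j l))) (Sum.inr ()) := trivial
    exact .cons haS h1 (.cons (hl _ (Or.inl rfl)) h2
      (.cons (hl _ (Or.inr rfl)) h3 (.refl ho)))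
  have reach : ∀ d : ℕ, ∀ a : Fin n, n - m - (a : ℕ) = d → Sum.inl (Sum.inl a) ∉ S →
      AvoidingReach (augE G) S (Sum.inl (Sum.inl a)) (Sum.inr ()) := by
    intro d
    induction d using Nat.strong_induction_on with
    | _ d ih =>
      intro a had haS
      by_cases ha : n - m ≤ (a : ℕ)
      · exact observed a ha haS
      let b : Fin p → Fin n := fun k => ⟨a + (k + 1), by omega⟩
      obtain ⟨k, hk⟩ := exists_disjoint_of_ncard_lt (fun k => {Sum.inl (Sum.inl (b k))})
        (by
          rintro k l v rfl h
          have := Fin.mk.inj (Sum.inl.inj (Sum.inl.inj h))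
          omega) S hlt
      have h1 : augE G (Sum.inl (Sum.inl a)) (Sum.inl (Sum.inl (b k))) :=
        hlow a _ (by omega) (k + 1) (by omega) rfl
      exact .cons haS h1 (ih _ (by simp only [b]; omega) (b k) rfl (hk _ rfl))
  obtain ⟨P, hP, hPS⟩ := reach _ x rfl hx
  obtain ⟨s, hs, hsP⟩ := hsep P hP
  exact hPS s hsP hs

/-- The relaxed platooning DCS digraph: agents `x_{n-m+1}, …, x_n` (0-indexed:
`n - m, …, n - 1`) are observed; each unobserved agent `x_i` has its self-loop plus
edges to `x_{i+1}, …, x_{i+p}`; and each observed agent has its self-loop plus edges to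
`p - 1` other observed agents arranged cyclically. Such a `G` has exactly
`np + n - m` agent-to-agent edges (self-loops included) and satisfies the full
robustness condition: every vertex separator of any `(x, o)` in the augmented graph
`G′` has cardinality at least `p`. -/
theorem relaxed_platooning_robustXY {n m p : ℕ} (hp : 1 ≤ p) (hpm : p ≤ m)
    (hmn : m ≤ n) (G : DCS n m)
    (hobs : ∀ j : Fin m, (G.obs j : ℕ) = n - m + (j : ℕ))
    (hE : ∀ a b : Fin n, G.E (Sum.inl a) (Sum.inl b) ↔
      (((a : ℕ) < n - m ∧ ∃ k ≤ p, (b : ℕ) = (a : ℕ) + k) ∨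
        (n - m ≤ (a : ℕ) ∧ (b = a ∨ ∃ l, 1 ≤ l ∧ l ≤ p - 1 ∧
          (b : ℕ) = n - m + (((a : ℕ) - (n - m)) + l) % m)))) :
    agentEdgeCount G = n * p + n - m ∧ RobustXY G p := by
  have hhigh : ∀ a b : Fin n, n - m ≤ (a : ℕ) → (G.E (Sum.inl a) (Sum.inl b) ↔
      ∃ l < p, (b : ℕ) = n - m + (((a : ℕ) - (n - m)) + l) % m) := by
    intro a b ha
    have ha0 : n - m + (((a : ℕ) - (n - m)) + 0) % m = a := by
      rw [Nat.mod_eq_of_lt (by omega)]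
      omega
    rw [hE]
    constructor
    · rintro (⟨h, -⟩ | ⟨-, rfl | ⟨l, -, hl, hb⟩⟩)
      · omega
      · exact ⟨0, hp, ha0.symm⟩
      · exact ⟨l, by omega, hb⟩
    · rintro ⟨l, hl, hb⟩
      refine Or.inr ⟨ha, ?_⟩
      rcases Nat.eq_zero_or_pos l with rfl | hl0
      · exact Or.inl (Fin.ext (hb.trans ha0))
      · exact Or.inr ⟨l, hl0, by omega, hb⟩
  have hlow : ∀ a b : Fin n, (a : ℕ) < n - m → (G.E (Sum.inl a) (Sum.inl b) ↔
      ∃ k < p + 1, (b : ℕ) = a + k) := by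
    intro a b ha
    simp [hE, ha, not_le.2 ha, -tsub_le_iff_right]
  refine ⟨?_, robustXY_of_edges hpm hmn G hobs
    (fun a b ha k hk hb => (hlow a b ha).2 ⟨k, by omega, hb⟩)
    (fun a b ha l hl hb => (hhigh a b ha).2 ⟨l, hl, hb⟩)⟩
  have hrow : ∀ a : Fin n, {b | G.E (Sum.inl a) (Sum.inl b)}.ncard =
      p + if (a : ℕ) < n - m then 1 else 0 := by
    intro a
    split_ifs with ha
    · simp_rw [hlow a _ ha]
      exact ncard_setOf_exists_lt _ (fun k hk => by omega) (fun k _ l _ h => by omega)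
    · simp_rw [hhigh a _ (not_lt.1 ha)]
      refine ncard_setOf_exists_lt _ (fun k hk => ?_) (fun k hk l hl h => ?_)
      · have := Nat.mod_lt ((a : ℕ) - (n - m) + k) (show 0 < m by omega)
        omega
      · exact add_mod_injOn (hk.trans_le hpm) (hl.trans_le hpm) (Nat.add_left_cancel h)
  rw [agentEdgeCount, ncard_setOf_prod fun a b => G.E (Sum.inl a) (Sum.inl b),
    Finset.sum_congr rfl fun a _ => hrow a, Finset.sum_add_distrib, Finset.sum_boole,
    Fin.card_filter_val_lt]
  simp only [Finset.sum_const, Finset.card_univ, Fintype.card_fin, smul_eq_mul, Nat.cast_id]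
  omega
end
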